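/- Fix ε > 0 and m ≥ 0 with 0 ≤ mε ≤ 1. Then the limit as t → +∞ over t ∈ εℤ of Σ_{x∈εℤ} a₁(x,t,m,ε)² exists and equals mε/(2√(1+m²ε²)). -/

import Mathlib

open scoped BigOperators

/-- The final x-coordinate of a checker path from `(0,0)` encoded by its sequence of moves
(`true` = move `(1,1)`, `false` = move `(-1,1)`). -/
def moveEndpoint {n : ℕ} (d : Fin n → Bool) : ℤ :=
  ∑ k, (if d k then (1 : ℤ) else -1)

/-- The number of turns of a checker path encoded by its sequence of moves. -/
def nturns {n : ℕ} (d : Fin n → Bool) : ℕ :=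
  ((List.ofFn d).zip (List.ofFn d).tail).countP fun p => p.1 != p.2

/-- Checker paths from `(0,0)` to `(x,t)` whose first step is to `(1,1)`,
encoded by their sequences of moves. -/
def cpaths (x t : ℤ) : Finset (Fin t.toNat → Bool) :=
  Finset.univ.filter fun d => moveEndpoint d = x ∧ (List.ofFn d).headI = true

/-- Feynman checkers amplitude with mass: `a(x·ε, t·ε, m, ε)` written in lattice
coordinates, i.e. `am m ε x t = (1+m²ε²)^((1-t)/2) * i * ∑ₛ (-i·m·ε)^turns(s)`. -/
noncomputable def am (m ε : ℝ) (x t : ℤ) : ℂ :=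
  (Real.sqrt (1 + m ^ 2 * ε ^ 2) : ℂ) ^ (1 - t) * Complex.I *
    ∑ d ∈ cpaths x t, (-Complex.I * (m * ε)) ^ nturns d


/-- Path sum with prescribed first step. -/
noncomputable def pathW (q : ℝ) (n : ℕ) (x : ℤ) (b : Bool) : ℂ :=
  ∑ d : Fin (n + 1) → Bool,
    if moveEndpoint d = x ∧ d 0 = b then (-Complex.I * q) ^ nturns d else 0

lemma nturns_cons {n : ℕ} (b : Bool) (d : Fin (n + 1) → Bool) :
    nturns (Fin.cons b d : Fin (n + 2) → Bool) = nturns d + if b = d 0 then 0 else 1 := by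
  unfold nturns
  rw [List.ofFn_succ (f := (Fin.cons b d : Fin (n + 2) → Bool))]
  simp only [Fin.cons_zero, Fin.cons_succ, List.tail_cons]
  have h : List.ofFn d = d 0 :: (List.ofFn d).tail := by
    rw [List.ofFn_succ]; simp
  conv_lhs => rw [h]
  rw [List.zip_cons_cons, List.countP_cons, ← h]
  by_cases hb : b = d 0 <;> simp [hb]

lemma moveEndpoint_cons {n : ℕ} (b : Bool) (d : Fin (n + 1) → Bool) :
    moveEndpoint (Fin.cons b d : Fin (n + 2) → Bool) =
      (if b then (1 : ℤ) else -1) + moveEndpoint d := by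
  unfold moveEndpoint
  rw [Fin.sum_univ_succ]
  simp

lemma pathW_succ (q : ℝ) (n : ℕ) (x : ℤ) (b : Bool) :
    pathW q (n + 1) x b = pathW q n (x - if b then (1 : ℤ) else -1) b +
      (-Complex.I * q) * pathW q n (x - if b then (1 : ℤ) else -1) (!b) := by
  unfold pathW
  rw [← (Fin.consEquiv (fun _ : Fin (n + 2) => Bool)).sum_comp, Fintype.sum_prod_type,
    Fintype.sum_bool, Finset.mul_sum, ← Finset.sum_add_distrib, ← Finset.sum_add_distrib]
  refine Finset.sum_congr rfl fun d _ => ?_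
  have hc : ∀ c : Bool, (Fin.consEquiv (fun _ : Fin (n + 2) => Bool)) (c, d) = Fin.cons c d :=
    fun _ => rfl
  have h5 : (-1 + moveEndpoint d = x) ↔ moveEndpoint d = x + 1 := by omega
  have h6 : (1 + moveEndpoint d = x) ↔ moveEndpoint d = x - 1 := by omega
  have h7 : x - -1 = x + 1 := by omega
  rw [hc, hc, moveEndpoint_cons, moveEndpoint_cons, nturns_cons, nturns_cons]
  cases b <;> cases h : d 0 <;> simp [h5, h6, h7, pow_succ']

/-- Real recursion for the amplitudes. -/
noncomputable def ps (q : ℝ) : ℕ → ℤ → ℝ × ℝ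
  | 0, x => (0, if x = -1 then 1 else 0)
  | n + 1, x => ((ps q n (x - 1)).1 - q * (ps q n (x - 1)).2,
      (ps q n (x + 1)).2 + q * (ps q n (x + 1)).1)

lemma pathW_zero (q : ℝ) (x : ℤ) (b : Bool) :
    pathW q 0 x b = if x = (if b then (1 : ℤ) else -1) then 1 else 0 := by
  unfold pathW
  rw [← (Equiv.funUnique (Fin 1) Bool).symm.sum_comp, Fintype.sum_bool]
  simp [nturns, moveEndpoint, Equiv.funUnique]
  cases b <;> simp [eq_comm]

lemma pathW_ps (q : ℝ) (n : ℕ) : ∀ x : ℤ,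
    (pathW q n x true).im = (ps q n x).1 ∧ (pathW q n x false).re = (ps q n x).2 := by
  induction n with
  | zero =>
    intro x
    rw [pathW_zero, pathW_zero]
    simp only [ps]
    constructor <;> split_ifs <;> simp_all
  | succ n ih =>
    intro x
    rw [pathW_succ, pathW_succ]
    simp only [ps, ← (ih _).1, ← (ih _).2]
    constructor
    · simp; ring
    · simp

lemma am_re (m ε : ℝ) (x : ℤ) (n : ℕ) :
    (am m ε x ((n : ℤ) + 1)).re =
      -((Real.sqrt (1 + m ^ 2 * ε ^ 2) ^ n)⁻¹ * (ps (m * ε) n x).1) := by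
  have h : (∑ d ∈ cpaths x ((n : ℤ) + 1), (-Complex.I * (m * ε)) ^ nturns d)
      = pathW (m * ε) n x true := by
    unfold cpaths pathW
    rw [Finset.sum_filter]
    have : ((n : ℤ) + 1).toNat = n + 1 := by omega
    rw [this]
    refine Finset.sum_congr rfl fun d _ => ?_
    rw [List.ofFn_succ]
    simp
  unfold am
  rw [h, ← (pathW_ps (m * ε) n x).1]
  have h2 : (1 : ℤ) - ((n : ℤ) + 1) = -(n : ℤ) := by ring
  rw [h2, zpow_neg, zpow_natCast, ← Complex.ofReal_pow, ← Complex.ofReal_inv, mul_assoc,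
    Complex.re_ofReal_mul]
  simp

lemma ps_rec (q : ℝ) (n : ℕ) (x : ℤ) : (ps q (n + 2) x).1 =
    (ps q (n + 1) (x - 1)).1 + (ps q (n + 1) (x + 1)).1 - (1 + q ^ 2) * (ps q n x).1 := by
  simp only [ps, sub_add_cancel, add_sub_cancel_right]
  ring

lemma ps_one (q : ℝ) (x : ℤ) : (ps q 1 x).1 = if x = 0 then -q else 0 := by
  simp only [ps]
  by_cases h : x = 0
  · simp [h]
  · have : ¬ (x - 1 = -1) := by omega
    simp [h, this]

instance factTwoPi : Fact (0 < 2 * Real.pi) := ⟨Real.two_pi_pos⟩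

/-- The Fourier transforms. -/
noncomputable def ft (q : ℝ) : ℕ → C(AddCircle (2 * Real.pi), ℂ)
  | 0 => 0
  | 1 => (-(q : ℂ)) • fourier 0
  | n + 2 => (fourier 1 * ft q (n + 1) + fourier (-1) * ft q (n + 1)) +
      (-(1 + (q : ℂ) ^ 2)) • ft q n

open MeasureTheory AddCircle in
lemma cint (f : C(AddCircle (2 * Real.pi), ℂ)) : Integrable f haarAddCircle :=
  f.continuous.integrable_of_hasCompactSupport (HasCompactSupport.of_compactSpace _)

lemma fc_add (f g : C(AddCircle (2 * Real.pi), ℂ)) (x : ℤ) :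
    fourierCoeff (f + g : C(AddCircle (2 * Real.pi), ℂ)) x =
      fourierCoeff f x + fourierCoeff g x := by
  rw [ContinuousMap.coe_add, fourierCoeff.add (cint f) (cint g)]
  rfl

lemma fc_mul (f : C(AddCircle (2 * Real.pi), ℂ)) (k x : ℤ) :
    fourierCoeff (fourier k * f : C(AddCircle (2 * Real.pi), ℂ)) x =
      fourierCoeff f (x - k) := by
  unfold fourierCoeff
  refine MeasureTheory.integral_congr_ae (Filter.Eventually.of_forall fun t => ?_)
  have : -(x - k) = -x + k := by ring
  simp only [ContinuousMap.mul_apply, smul_eq_mul, this, fourier_add]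
  ring

lemma fc_smul (f : C(AddCircle (2 * Real.pi), ℂ)) (c : ℂ) (x : ℤ) :
    fourierCoeff (c • f : C(AddCircle (2 * Real.pi), ℂ)) x = c * fourierCoeff f x := by
  rw [ContinuousMap.coe_smul]
  exact fourierCoeff.const_smul _ _ _

lemma ft_coeff (q : ℝ) : ∀ (n : ℕ) (x : ℤ), fourierCoeff (ft q n) x = ((ps q n x).1 : ℂ)
  | 0, x => by simp [ft, ps, fourierCoeff]
  | 1, x => by
      rw [ft, fc_smul, fourierCoeff_fourier, ps_one]
      by_cases h : x = 0 <;> simp [h]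
  | n + 2, x => by
      rw [ft, fc_add, fc_add, fc_mul, fc_mul, fc_smul, ft_coeff q n, ft_coeff q (n + 1),
        ft_coeff q (n + 1), ps_rec]
      push_cast
      simp only [sub_neg_eq_add]
      ring

lemma parseval (f : C(AddCircle (2 * Real.pi), ℂ)) :
    ∑' x : ℤ, ‖fourierCoeff f x‖ ^ 2 =
      (2 * Real.pi)⁻¹ * ∫ p in (-Real.pi)..Real.pi, ‖f (p : AddCircle (2 * Real.pi))‖ ^ 2 := by
  have h := tsum_sq_fourierCoeff
    (ContinuousMap.toLp (E := ℂ) 2 AddCircle.haarAddCircle ℂ f)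
  simp only [fourierCoeff_toLp] at h
  rw [h]
  have h2 : ∫ t : AddCircle (2 * Real.pi),
      ‖(ContinuousMap.toLp (E := ℂ) 2 AddCircle.haarAddCircle ℂ f) t‖ ^ 2
        ∂AddCircle.haarAddCircle = ∫ t : AddCircle (2 * Real.pi), ‖f t‖ ^ 2
        ∂AddCircle.haarAddCircle := by
    refine MeasureTheory.integral_congr_ae ?_
    filter_upwards [ContinuousMap.coeFn_toLp (p := 2) (𝕜 := ℂ) AddCircle.haarAddCircle f]
      with t ht
    rw [ht]
  rw [h2, AddCircle.integral_haarAddCircle,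
    ← AddCircle.intervalIntegral_preimage (2 * Real.pi) (-Real.pi), smul_eq_mul]
  have : -Real.pi + 2 * Real.pi = Real.pi := by ring
  rw [this]

/-- The angle `ω(p)`. -/
noncomputable def om (q p : ℝ) : ℝ := Real.arccos (Real.cos p / Real.sqrt (1 + q ^ 2))

lemma sqrt_gt (q : ℝ) (hq : 0 < q) : 1 < Real.sqrt (1 + q ^ 2) := by
  rw [Real.lt_sqrt] <;> nlinarith

lemma cos_om_bd (q : ℝ) (hq : 0 < q) (p : ℝ) : -1 < Real.cos p / Real.sqrt (1 + q ^ 2) ∧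
    Real.cos p / Real.sqrt (1 + q ^ 2) < 1 := by
  have h := sqrt_gt q hq
  rw [lt_div_iff₀ (by linarith), div_lt_one (by linarith)]
  constructor
  · linarith [Real.neg_one_le_cos p]
  · linarith [Real.cos_le_one p]

lemma cos_om (q : ℝ) (hq : 0 < q) (p : ℝ) :
    Real.cos (om q p) = Real.cos p / Real.sqrt (1 + q ^ 2) :=
  Real.cos_arccos (cos_om_bd q hq p).1.le (cos_om_bd q hq p).2.le

lemma sin_om_pos (q : ℝ) (hq : 0 < q) (p : ℝ) : 0 < Real.sin (om q p) := by
  unfold om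
  rw [Real.sin_arccos]
  apply Real.sqrt_pos.mpr
  have h := cos_om_bd q hq p
  nlinarith

lemma sin_om_sq (q : ℝ) (hq : 0 < q) (p : ℝ) :
    Real.sin (om q p) ^ 2 = (q ^ 2 + Real.sin p ^ 2) / (1 + q ^ 2) := by
  rw [Real.sin_sq, cos_om q hq, div_pow, Real.sq_sqrt (by positivity), Real.sin_sq]
  field_simp
  ring

lemma four_cos (p : ℝ) : (fourier 1 (p : AddCircle (2 * Real.pi)) : ℂ) +
    fourier (-1) (p : AddCircle (2 * Real.pi)) = 2 * Real.cos p := by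
  rw [fourier_coe_apply, fourier_coe_apply]
  rw [Complex.ofReal_cos, Complex.two_cos]
  have hpi : (Real.pi : ℂ) ≠ 0 := by exact_mod_cast Real.pi_ne_zero
  congr 2
  · push_cast; field_simp
  · push_cast; field_simp

lemma ft_apply (q : ℝ) (hq : 0 < q) (p : ℝ) : ∀ n : ℕ,
    ft q n (p : AddCircle (2 * Real.pi)) =
      ((-q * Real.sqrt (1 + q ^ 2) ^ n / Real.sqrt (1 + q ^ 2) *
        (Real.sin (n * om q p) / Real.sin (om q p)) : ℝ) : ℂ)
  | 0 => by simp [ft]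
  | 1 => by
      have h1 := (sin_om_pos q hq p).ne'
      have h2 : Real.sqrt (1 + q ^ 2) ≠ 0 := by linarith [sqrt_gt q hq]
      simp only [ft, ContinuousMap.smul_apply, fourier_zero, smul_eq_mul, mul_one, Nat.cast_one,
        one_mul, pow_one]
      rw [div_self h1, mul_div_assoc, div_self h2]
      simp
  | n + 2 => by
      have h1 := (sin_om_pos q hq p).ne'
      have h2 : Real.sqrt (1 + q ^ 2) ≠ 0 := by linarith [sqrt_gt q hq]
      have h3 : Real.sqrt (1 + q ^ 2) ^ 2 = 1 + q ^ 2 := Real.sq_sqrt (by positivity)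
      have h4 := cos_om q hq p
      simp only [ft, ContinuousMap.add_apply, ContinuousMap.mul_apply, ContinuousMap.smul_apply,
        smul_eq_mul]
      rw [← add_mul, four_cos, ft_apply q hq p n, ft_apply q hq p (n + 1)]
      have h5 : Real.sin (((n + 2 : ℕ) : ℝ) * om q p) =
          2 * Real.cos (om q p) * Real.sin (((n + 1 : ℕ) : ℝ) * om q p)
            - Real.sin ((n : ℝ) * om q p) := by
        have e1 : ((n + 2 : ℕ) : ℝ) * om q p = ((n + 1 : ℕ) : ℝ) * om q p + om q p := by
          push_cast; ring
        have e2 : (n : ℝ) * om q p = ((n + 1 : ℕ) : ℝ) * om q p - om q p := by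
          push_cast; ring
        rw [e1, e2, Real.sin_add, Real.sin_sub]
        ring
      rw [h5]
      have h6 : Real.cos p = Real.cos (om q p) * Real.sqrt (1 + q ^ 2) := by
        rw [h4]; field_simp
      have h7 : -(1 + (q : ℂ) ^ 2) = ((-(Real.sqrt (1 + q ^ 2) ^ 2) : ℝ) : ℂ) := by
        rw [h3]; push_cast; ring
      rw [h6, h7]
      norm_cast
      generalize Real.sqrt (1 + q ^ 2) = r at *
      field_simp
      ring

/-- The weight. -/
noncomputable def kw (q p : ℝ) : ℝ := q ^ 2 / (q ^ 2 + Real.sin p ^ 2)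

lemma kw_cont (q : ℝ) (hq : 0 < q) : Continuous (kw q) := by
  unfold kw
  refine Continuous.div (by fun_prop) (by fun_prop) fun p => ?_
  positivity

lemma om_cont (q : ℝ) : Continuous (om q) := by
  unfold om
  exact Real.continuous_arccos.comp (Real.continuous_cos.div_const _)

lemma sum_eq (m ε : ℝ) (hq : 0 < m * ε) (n : ℕ) :
    ∑' x : ℤ, (am m ε x ((n : ℤ) + 1)).re ^ 2 = (2 * Real.pi)⁻¹ *
      ∫ p in (-Real.pi)..Real.pi, kw (m * ε) p * Real.sin (n * om (m * ε) p) ^ 2 := by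
  have hs : 1 + m ^ 2 * ε ^ 2 = 1 + (m * ε) ^ 2 := by ring
  have h1 : ∀ x : ℤ, (am m ε x ((n : ℤ) + 1)).re ^ 2 =
      ((Real.sqrt (1 + (m * ε) ^ 2) ^ n)⁻¹) ^ 2 * ‖fourierCoeff (ft (m * ε) n) x‖ ^ 2 := by
    intro x
    rw [am_re, ft_coeff, Complex.norm_real, Real.norm_eq_abs, sq_abs, hs]
    ring
  simp_rw [h1]
  generalize m * ε = q at *
  rw [tsum_mul_left, parseval, mul_left_comm, ← intervalIntegral.integral_const_mul]
  congr 1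
  refine intervalIntegral.integral_congr fun p _ => ?_
  have h2 := (sin_om_pos q hq p).ne'
  have h3 : Real.sqrt (1 + q ^ 2) ≠ 0 := by linarith [sqrt_gt q hq]
  have h4 : Real.sqrt (1 + q ^ 2) ^ 2 = 1 + q ^ 2 := Real.sq_sqrt (by positivity)
  have h5 := sin_om_sq q hq p
  have h6 : kw q p = q ^ 2 / (Real.sqrt (1 + q ^ 2) ^ 2 * Real.sin (om q p) ^ 2) := by
    rw [h5, h4, kw]
    have : (1 + q ^ 2) ≠ 0 := by positivity
    field_simp
  rw [ft_apply q hq p n, Complex.norm_real, Real.norm_eq_abs, sq_abs, h6]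
  generalize Real.sqrt (1 + q ^ 2) = r at *
  field_simp

lemma kw_even (q p : ℝ) : kw q (-p) = kw q p := by simp [kw]
lemma om_even (q p : ℝ) : om q (-p) = om q p := by simp [om]

lemma even_int (f : ℝ → ℝ) (hf : Continuous f) (he : ∀ x, f (-x) = f x) (a : ℝ) :
    ∫ p in (-a)..a, f p = 2 * ∫ p in (0 : ℝ)..a, f p := by
  rw [← intervalIntegral.integral_add_adjacent_intervals (b := 0)
    (hf.intervalIntegrable _ _) (hf.intervalIntegrable _ _)]
  have : ∫ p in (-a)..0, f p = ∫ p in (0 : ℝ)..a, f p := by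
    have h := intervalIntegral.integral_comp_neg (a := 0) (b := a) f
    simp only [he, neg_zero] at h
    exact h.symm
  rw [this]; ring

lemma kw_int (q : ℝ) (hq : 0 < q) :
    ∫ p in (0 : ℝ)..Real.pi, kw q p = Real.pi * (q / Real.sqrt (1 + q ^ 2)) := by
  have hr : 0 < Real.sqrt (1 + q ^ 2) := by linarith [sqrt_gt q hq]
  have hr2 : Real.sqrt (1 + q ^ 2) ^ 2 = 1 + q ^ 2 := Real.sq_sqrt (by positivity)
  generalize Real.sqrt (1 + q ^ 2) = r at *
  have hd : ∀ p : ℝ, HasDerivAt (fun p => (q / r) * (p + Real.arctan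
      ((r - q) * (Real.sin p * Real.cos p) / (q * Real.cos p ^ 2 + r * Real.sin p ^ 2))))
      (kw q p) p := by
    intro p
    have hsc := Real.sin_sq_add_cos_sq p
    have hD : 0 < q * Real.cos p ^ 2 + r * Real.sin p ^ 2 := by
      rcases lt_or_ge q r with h | h
      · nlinarith [sq_nonneg (Real.sin p), sq_nonneg (Real.cos p)]
      · nlinarith [sq_nonneg (Real.sin p), sq_nonneg (Real.cos p)]
    have hs := Real.hasDerivAt_sin p
    have hc := Real.hasDerivAt_cos p
    have h := (((hasDerivAt_id p).add ((((hs.mul hc).const_mul (r - q)).div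
      (((hc.pow 2).const_mul q).add ((hs.pow 2).const_mul r)) hD.ne').arctan)).const_mul (q / r))
    refine h.congr_deriv ?_
    simp only [Pi.mul_apply, Pi.add_apply, Pi.pow_apply, Pi.div_apply]
    unfold kw
    have hE : 0 < q ^ 2 + Real.sin p ^ 2 := by positivity
    generalize Real.sin p = s at *
    generalize Real.cos p = c at *
    have hF : 0 < (q * c ^ 2 + r * s ^ 2) ^ 2 + ((r - q) * (s * c)) ^ 2 := by positivity
    have hFe : (q * c ^ 2 + r * s ^ 2) ^ 2 + ((r - q) * (s * c)) ^ 2 = q ^ 2 + s ^ 2 := by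
      have : (q * c ^ 2 + r * s ^ 2) ^ 2 + ((r - q) * (s * c)) ^ 2 =
        (s ^ 2 + c ^ 2) * (q ^ 2 * (c ^ 2 + s ^ 2) + (r ^ 2 - q ^ 2) * s ^ 2) := by ring
      rw [this, hr2, add_comm (c ^ 2), hsc]; ring
    have hA : 1 + ((r - q) * (s * c) / (q * c ^ 2 + r * s ^ 2)) ^ 2 =
        (q ^ 2 + s ^ 2) / (q * c ^ 2 + r * s ^ 2) ^ 2 := by
      rw [← hFe]; field_simp
    have hc2 : c ^ 2 = 1 - s ^ 2 := by linarith
    have hN : (r - q) * (c * c + s * -s) * (q * c ^ 2 + r * s ^ 2) -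
        (r - q) * (s * c) * (q * (((2 : ℕ) : ℝ) * c ^ (2 - 1) * -s) +
          r * (((2 : ℕ) : ℝ) * s ^ (2 - 1) * c)) = r * q - (q ^ 2 + s ^ 2) := by
      have e1 : (r - q) * (c * c + s * -s) * (q * c ^ 2 + r * s ^ 2) -
        (r - q) * (s * c) * (q * (((2 : ℕ) : ℝ) * c ^ (2 - 1) * -s) +
          r * (((2 : ℕ) : ℝ) * s ^ (2 - 1) * c)) =
          (r - q) * ((c ^ 2 - s ^ 2) * (q * c ^ 2 + r * s ^ 2) +
            2 * s ^ 2 * c ^ 2 * (q - r)) := by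
        norm_num; ring
      rw [e1, hc2]
      linear_combination (-s ^ 2) * hr2
    rw [hA, hN]
    field_simp
    ring
  rw [intervalIntegral.integral_eq_sub_of_hasDerivAt (fun p _ => hd p)
    ((kw_cont q hq).intervalIntegrable _ _)]
  simp
  ring

lemma om_deriv (q : ℝ) (hq : 0 < q) (p : ℝ) : HasDerivAt (om q)
    (Real.sin p / (Real.sqrt (1 + q ^ 2) * Real.sin (om q p))) p := by
  have hb := cos_om_bd q hq p
  have h := (Real.hasDerivAt_arccos hb.1.ne' hb.2.ne).comp p
    ((Real.hasDerivAt_cos p).div_const (Real.sqrt (1 + q ^ 2)))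
  refine h.congr_deriv ?_
  rw [← Real.sin_arccos]
  change _ = Real.sin p / (Real.sqrt (1 + q ^ 2) *
    Real.sin (Real.arccos (Real.cos p / Real.sqrt (1 + q ^ 2))))
  generalize Real.sin (Real.arccos (Real.cos p / Real.sqrt (1 + q ^ 2))) = u
  by_cases hu : u = 0
  · simp [hu]
  have h3 : Real.sqrt (1 + q ^ 2) ≠ 0 := by linarith [sqrt_gt q hq]
  field_simp

lemma om_inj (q : ℝ) (hq : 0 < q) : Set.InjOn (om q) (Set.Ioo 0 Real.pi) := by
  intro a ha b hb hab
  have h := congrArg Real.cos hab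
  rw [cos_om q hq, cos_om q hq] at h
  have h3 : Real.sqrt (1 + q ^ 2) ≠ 0 := by linarith [sqrt_gt q hq]
  exact Real.injOn_cos (Set.Ioo_subset_Icc_self ha) (Set.Ioo_subset_Icc_self hb)
    ((div_left_inj' h3).mp h)

open Filter Topology MeasureTheory in
lemma osc (q : ℝ) (hq : 0 < q) :
    Tendsto (fun n : ℕ => ∫ p in (0 : ℝ)..Real.pi, kw q p * Real.cos (2 * n * om q p))
      atTop (𝓝 0) := by
  set S := Set.Ioo (0 : ℝ) Real.pi
  set D : ℝ → ℝ := fun p => Real.sin p / (Real.sqrt (1 + q ^ 2) * Real.sin (om q p))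
  set inv := Function.invFunOn (om q) S
  set G : ℝ → ℂ := fun w => (((|D (inv w)|)⁻¹ * kw q (inv w) : ℝ) : ℂ)
  have hinv : ∀ p ∈ S, inv (om q p) = p := fun p hp => (om_inj q hq).leftInvOn_invFunOn hp
  have hsqrt : 0 < Real.sqrt (1 + q ^ 2) := by linarith [sqrt_gt q hq]
  have hD : ∀ p ∈ S, 0 < D p := fun p hp =>
    div_pos (Real.sin_pos_of_mem_Ioo hp) (mul_pos hsqrt (sin_om_pos q hq p))
  have himg : MeasurableSet (om q '' S) :=
    measurableSet_Ioo.image_of_continuousOn_injOn (om_cont q).continuousOn (om_inj q hq)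
  have hRL := Real.tendsto_integral_exp_smul_cocompact ((om q '' S).indicator G)
  have hw : Tendsto (fun n : ℕ => (n : ℝ) / Real.pi) atTop (cocompact ℝ) :=
    (tendsto_natCast_atTop_atTop.atTop_div_const Real.pi_pos).mono_right atTop_le_cocompact
  have h1 := (Complex.continuous_re.tendsto _).comp (hRL.comp hw)
  simp only [Complex.zero_re] at h1
  refine h1.congr fun n => ?_
  simp only [Function.comp]
  have h2 : ∀ v : ℝ, (Real.fourierChar (-(v * (n / Real.pi))) • (om q '' S).indicator G v : ℂ) =
      (om q '' S).indicator (fun v => Complex.exp (((-(2 * n * v) : ℝ) : ℂ) * Complex.I) * G v) v := by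
    intro v
    by_cases hv : v ∈ om q '' S
    · rw [Set.indicator_of_mem hv, Set.indicator_of_mem hv, Circle.smul_def,
        Real.fourierChar_apply, smul_eq_mul]
      congr 4
      have := Real.pi_ne_zero
      field_simp
    · rw [Set.indicator_of_notMem hv, Set.indicator_of_notMem hv, smul_zero]
  simp_rw [h2]
  rw [integral_indicator himg, integral_image_eq_integral_abs_deriv_smul measurableSet_Ioo
    (fun p _ => (om_deriv q hq p).hasDerivWithinAt) (om_inj q hq)]
  have h3 : ∫ p in S, |D p| • (Complex.exp (((-(2 * n * om q p) : ℝ) : ℂ) * Complex.I) * G (om q p))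
      = ∫ p in S, (kw q p : ℂ) * Complex.exp (((-(2 * n * om q p) : ℝ) : ℂ) * Complex.I) := by
    refine setIntegral_congr_fun measurableSet_Ioo fun p hp => ?_
    have hDp := hD p hp
    simp only [G]
    rw [hinv p hp, abs_of_pos hDp, Complex.real_smul]
    have : (D p : ℂ) ≠ 0 := by exact_mod_cast hDp.ne'
    push_cast
    field_simp
  refine (congrArg Complex.re h3).trans ?_
  have hci : IntegrableOn (fun p => (kw q p : ℂ) *
      Complex.exp (((-(2 * n * om q p) : ℝ) : ℂ) * Complex.I)) S := by
    have hc : Continuous (fun p => (kw q p : ℂ) *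
        Complex.exp (((-(2 * n * om q p) : ℝ) : ℂ) * Complex.I)) := by
      have := kw_cont q hq
      have := om_cont q
      fun_prop
    exact (hc.integrableOn_Icc (a := 0) (b := Real.pi)).mono_set Set.Ioo_subset_Icc_self
  have h4 := integral_re (𝕜 := ℂ) hci
  simp only [RCLike.re_eq_complex_re] at h4
  rw [← h4, intervalIntegral.integral_of_le Real.pi_pos.le, integral_Ioc_eq_integral_Ioo]
  refine setIntegral_congr_fun measurableSet_Ioo fun p hp => ?_
  rw [Complex.re_ofReal_mul, Complex.exp_ofReal_mul_I_re, Real.cos_neg]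

open Filter Topology MeasureTheory in
lemma lim_pos (m ε : ℝ) (hq : 0 < m * ε) :
    Tendsto (fun n : ℕ => ∑' x : ℤ, (am m ε x ((n : ℤ) + 1)).re ^ 2) atTop
      (𝓝 (m * ε / (2 * Real.sqrt (1 + m ^ 2 * ε ^ 2)))) := by
  have hs : 1 + m ^ 2 * ε ^ 2 = 1 + (m * ε) ^ 2 := by ring
  simp_rw [sum_eq m ε hq]
  rw [hs]
  generalize m * ε = q at *
  have hk := kw_cont q hq
  have ho := om_cont q
  have h := ((osc q hq).const_sub (Real.pi * (q / Real.sqrt (1 + q ^ 2)))).const_mul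
    ((2 * Real.pi)⁻¹)
  have hpi := Real.pi_ne_zero
  have h3 : Real.sqrt (1 + q ^ 2) ≠ 0 := by linarith [sqrt_gt q hq]
  have e : (2 * Real.pi)⁻¹ * (Real.pi * (q / Real.sqrt (1 + q ^ 2)) - 0) =
      q / (2 * Real.sqrt (1 + q ^ 2)) := by field_simp; ring
  rw [e] at h
  refine h.congr fun n => ?_
  congr 1
  rw [even_int _ (by fun_prop) (fun x => by rw [kw_even, om_even]), ← kw_int q hq,
    ← intervalIntegral.integral_sub (hk.intervalIntegrable _ _)
      ((by fun_prop : Continuous fun p => kw q p * Real.cos (2 * n * om q p)).intervalIntegrable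
        _ _), ← intervalIntegral.integral_const_mul]
  refine intervalIntegral.integral_congr fun p _ => ?_
  rw [mul_assoc 2, Real.cos_two_mul, Real.cos_sq']
  ring

lemma ps_q_zero : ∀ (n : ℕ) (x : ℤ), (ps 0 n x).1 = 0
  | 0, x => rfl
  | n + 1, x => by simp [ps, ps_q_zero n]

/-- Probability of direction reversal (limit): for `0 ≤ mε ≤ 1`, the sum
`∑_{x ∈ εℤ} a₁(x,t,m,ε)²` tends to `mε / (2√(1+m²ε²))` as `t → +∞` over `t ∈ εℤ`. -/
theorem probability_of_direction_reversal_limit (m ε : ℝ) (hε : 0 < ε) (hm : 0 ≤ m)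
    (hme : m * ε ≤ 1) :
    Filter.Tendsto (fun t : ℤ => ∑' x : ℤ, (am m ε x t).re ^ 2) Filter.atTop
      (nhds (m * ε / (2 * Real.sqrt (1 + m ^ 2 * ε ^ 2)))) := by
  rw [← Nat.map_cast_int_atTop, Filter.tendsto_map'_iff, ← Filter.tendsto_add_atTop_iff_nat 1]
  have hfun : (fun n : ℕ => ((fun t : ℤ => ∑' x : ℤ, (am m ε x t).re ^ 2) ∘ fun n : ℕ => (n : ℤ))
      (n + 1)) = fun n : ℕ => ∑' x : ℤ, (am m ε x ((n : ℤ) + 1)).re ^ 2 := by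
    funext n
    simp
  rw [hfun]
  rcases (mul_nonneg hm hε.le).eq_or_lt with h0 | h0
  · have hz : ∀ (n : ℕ) (x : ℤ), (am m ε x ((n : ℤ) + 1)).re = 0 := by
      intro n x
      rw [am_re, ← h0, ps_q_zero]
      simp
    simp [hz, ← h0]
  · exact lim_pos m ε h0
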